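/- Let f : [0,1]² → ℝ be continuous and nonnegative, and let u be the associated value function. Then u is monotone nondecreasing: if x, y ∈ [0,1]² satisfy x₁ ≤ y₁ and x₂ ≤ y₂, then u(x) ≤ u(y). -/

import Mathlib

open Set MeasureTheory

/-- The point reached at time `t` by the monotone absolutely continuous path
component with (a.e.) derivative `g` starting at `0`:  `φ(t) = ∫₀ᵗ g`. -/
noncomputable def pathPoint (g : ℝ → ℝ) (t : ℝ) : ℝ :=
  ∫ s in (0:ℝ)..t, g s

/-- The cost `∫ₛᵗ f(φ(r)) √(φ₁'(r) φ₂'(r)) dr` of the path with component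
derivatives `g₁, g₂`. -/
noncomputable def pathCost (f : ℝ × ℝ → ℝ) (g₁ g₂ : ℝ → ℝ) (s t : ℝ) : ℝ :=
  ∫ r in s..t, f (pathPoint g₁ r, pathPoint g₂ r) * Real.sqrt (g₁ r * g₂ r)

/-- `g₁, g₂` are the (a.e.) derivatives of an admissible path from `(0,0)` to
`x`: each component is absolutely continuous (being an integral of an
integrable function) and monotone nondecreasing (`gᵢ ≥ 0`), and the path ends
at `x`. -/
def IsAdmissiblePath (x : ℝ × ℝ) (g₁ g₂ : ℝ → ℝ) : Prop :=
  IntervalIntegrable g₁ volume 0 1 ∧ IntervalIntegrable g₂ volume 0 1 ∧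
  (∀ t, 0 ≤ g₁ t) ∧ (∀ t, 0 ≤ g₂ t) ∧
  pathPoint g₁ 1 = x.1 ∧ pathPoint g₂ 1 = x.2

/-- The value function `u(x) = sup_{φ ∈ A(x)} ∫₀¹ f(φ(t)) √(φ₁'(t) φ₂'(t)) dt`. -/
noncomputable def valueFun (f : ℝ × ℝ → ℝ) (x : ℝ × ℝ) : ℝ :=
  sSup { J : ℝ | ∃ g₁ g₂ : ℝ → ℝ, IsAdmissiblePath x g₁ g₂ ∧ J = pathCost f g₁ g₂ 0 1 }


theorem pathPoint_mem_Icc {g : ℝ → ℝ} {a t : ℝ} (hg : IntervalIntegrable g volume 0 1)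
    (hg0 : ∀ t, 0 ≤ g t) (h1 : pathPoint g 1 = a) (ht : t ∈ Icc (0:ℝ) 1) :
    pathPoint g t ∈ Icc 0 a := by
  refine ⟨intervalIntegral.integral_nonneg ht.1 fun s _ => hg0 s, ?_⟩
  rw [← h1]
  exact intervalIntegral.integral_mono_interval le_rfl ht.1 ht.2
    (Filter.Eventually.of_forall hg0) hg

theorem continuousOn_pathPoint {g : ℝ → ℝ} (hg : IntervalIntegrable g volume 0 1) :
    ContinuousOn (pathPoint g) (Icc 0 1) := by
  have h := intervalIntegral.continuousOn_primitive_interval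
    ((intervalIntegrable_iff_integrableOn_Icc_of_le zero_le_one).1 hg |>.mono_set
      (uIcc_of_le (zero_le_one' ℝ)).le)
  rwa [uIcc_of_le (zero_le_one' ℝ)] at h

theorem sqrt_mul_le_half_add {a b : ℝ} (ha : 0 ≤ a) (hb : 0 ≤ b) :
    √(a * b) ≤ (a + b) / 2 :=
  Real.sqrt_le_iff.2 ⟨by positivity, by nlinarith [sq_nonneg (a - b)]⟩

theorem IntervalIntegrable.sqrt_mul {g₁ g₂ : ℝ → ℝ} {a b : ℝ}
    (h₁ : IntervalIntegrable g₁ volume a b) (h₂ : IntervalIntegrable g₂ volume a b)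
    (hp₁ : ∀ t, 0 ≤ g₁ t) (hp₂ : ∀ t, 0 ≤ g₂ t) :
    IntervalIntegrable (fun t => √(g₁ t * g₂ t)) volume a b := by
  refine ((h₁.add h₂).div_const 2).mono_fun ?_ (Filter.Eventually.of_forall fun t => ?_)
  · exact Real.continuous_sqrt.comp_aestronglyMeasurable
      (h₁.def'.aestronglyMeasurable.mul h₂.def'.aestronglyMeasurable)
  · beta_reduce
    rw [Real.norm_of_nonneg (Real.sqrt_nonneg _)]
    exact (sqrt_mul_le_half_add (hp₁ t) (hp₂ t)).trans (Real.le_norm_self _)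

namespace IsAdmissiblePath

variable {f : ℝ × ℝ → ℝ} {x : ℝ × ℝ} {g₁ g₂ : ℝ → ℝ}

theorem mem_unitSquare (h : IsAdmissiblePath x g₁ g₂) (hx : x ∈ Icc (0:ℝ) 1 ×ˢ Icc (0:ℝ) 1)
    {t : ℝ} (ht : t ∈ Icc (0:ℝ) 1) :
    (pathPoint g₁ t, pathPoint g₂ t) ∈ Icc (0:ℝ) 1 ×ˢ Icc (0:ℝ) 1 := by
  obtain ⟨i₁, i₂, p₁, p₂, e₁, e₂⟩ := h
  exact ⟨Icc_subset_Icc_right hx.1.2 (pathPoint_mem_Icc i₁ p₁ e₁ ht),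
    Icc_subset_Icc_right hx.2.2 (pathPoint_mem_Icc i₂ p₂ e₂ ht)⟩

theorem intervalIntegrable_cost (h : IsAdmissiblePath x g₁ g₂)
    (hf : ContinuousOn f (Icc 0 1 ×ˢ Icc 0 1)) (hx : x ∈ Icc (0:ℝ) 1 ×ˢ Icc (0:ℝ) 1) :
    IntervalIntegrable
      (fun r => f (pathPoint g₁ r, pathPoint g₂ r) * √(g₁ r * g₂ r)) volume 0 1 := by
  refine (h.1.sqrt_mul h.2.1 h.2.2.1 h.2.2.2.1).continuousOn_mul ?_
  rw [uIcc_of_le (zero_le_one' ℝ)]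
  exact hf.comp ((continuousOn_pathPoint h.1).prodMk (continuousOn_pathPoint h.2.1))
    fun t ht => h.mem_unitSquare hx ht

theorem pathCost_le (h : IsAdmissiblePath x g₁ g₂)
    (hf : ContinuousOn f (Icc 0 1 ×ˢ Icc 0 1)) (hx : x ∈ Icc (0:ℝ) 1 ×ˢ Icc (0:ℝ) 1)
    {M : ℝ} (hM0 : 0 ≤ M) (hM : ∀ z ∈ Icc (0:ℝ) 1 ×ˢ Icc (0:ℝ) 1, f z ≤ M) :
    pathCost f g₁ g₂ 0 1 ≤ M * ((x.1 + x.2) / 2) := by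
  have e : M * ((x.1 + x.2) / 2) = ∫ r in (0:ℝ)..1, M * ((g₁ r + g₂ r) / 2) := by
    rw [intervalIntegral.integral_const_mul, intervalIntegral.integral_div,
      intervalIntegral.integral_add h.1 h.2.1, ← h.2.2.2.2.1, ← h.2.2.2.2.2]
    rfl
  rw [e]
  refine intervalIntegral.integral_mono_on zero_le_one (h.intervalIntegrable_cost hf hx)
    (((h.1.add h.2.1).div_const 2).const_mul M) fun r hr => ?_
  exact mul_le_mul (hM _ (h.mem_unitSquare hx hr))
    (sqrt_mul_le_half_add (h.2.2.1 r) (h.2.2.2.1 r)) (Real.sqrt_nonneg _) hM0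

end IsAdmissiblePath

theorem bddAbove_pathCost {f : ℝ × ℝ → ℝ} {x : ℝ × ℝ}
    (hf : ContinuousOn f (Icc 0 1 ×ˢ Icc 0 1)) (hx : x ∈ Icc (0:ℝ) 1 ×ˢ Icc (0:ℝ) 1) :
    BddAbove {J : ℝ | ∃ g₁ g₂ : ℝ → ℝ, IsAdmissiblePath x g₁ g₂ ∧ J = pathCost f g₁ g₂ 0 1} := by
  obtain ⟨M, hM⟩ := (isCompact_Icc.prod isCompact_Icc).bddAbove_image hf
  refine ⟨max M 0 * ((x.1 + x.2) / 2), ?_⟩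
  rintro J ⟨g₁, g₂, h, rfl⟩
  exact h.pathCost_le hf hx (le_max_right _ _)
    fun z hz => (hM (mem_image_of_mem f hz)).trans (le_max_left _ _)

theorem isAdmissiblePath_const {x : ℝ × ℝ} (hx : x ∈ Icc (0:ℝ) 1 ×ˢ Icc (0:ℝ) 1) :
    IsAdmissiblePath x (fun _ => x.1) (fun _ => x.2) :=
  ⟨intervalIntegrable_const, intervalIntegrable_const, fun _ => hx.1.1, fun _ => hx.2.1,
    by simp [pathPoint], by simp [pathPoint]⟩

/-- The density of the path component that runs through the path with density `g` at double
speed during `[0, 1/2]`, then increases linearly by `c` during `[1/2, 1]`. -/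
noncomputable def extendDensity (g : ℝ → ℝ) (c t : ℝ) : ℝ :=
  if t ≤ 1 / 2 then 2 * g (2 * t) else 2 * c

section extendDensity

variable {g : ℝ → ℝ} {c t : ℝ}

theorem extendDensity_of_le (ht : t ≤ 1 / 2) : extendDensity g c t = 2 * g (2 * t) := if_pos ht

theorem extendDensity_of_gt (ht : 1 / 2 < t) : extendDensity g c t = 2 * c := if_neg ht.not_ge

theorem extendDensity_nonneg (hg : ∀ t, 0 ≤ g t) (hc : 0 ≤ c) (t : ℝ) :
    0 ≤ extendDensity g c t := by
  unfold extendDensity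
  split_ifs
  · exact mul_nonneg zero_le_two (hg _)
  · exact mul_nonneg zero_le_two hc

theorem intervalIntegrable_extendDensity_left (hg : IntervalIntegrable g volume 0 1) :
    IntervalIntegrable (extendDensity g c) volume 0 (1 / 2) := by
  have h := (hg.comp_mul_left (c := 2)).const_mul 2
  rw [zero_div] at h
  refine h.congr fun t ht => ?_
  rw [uIoc_of_le (by norm_num)] at ht
  exact (extendDensity_of_le ht.2).symm

theorem intervalIntegrable_extendDensity_right :
    IntervalIntegrable (extendDensity g c) volume (1 / 2) 1 := by
  refine (intervalIntegrable_const (c := 2 * c)).congr fun t ht => ?_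
  rw [uIoc_of_le (by norm_num)] at ht
  exact (extendDensity_of_gt ht.1).symm

theorem pathPoint_extendDensity_of_le (ht0 : 0 ≤ t) (ht : t ≤ 1 / 2) :
    pathPoint (extendDensity g c) t = pathPoint g (2 * t) := by
  have h : pathPoint (extendDensity g c) t = ∫ s in (0:ℝ)..t, 2 * g (2 * s) := by
    refine intervalIntegral.integral_congr fun s hs => ?_
    rw [uIcc_of_le ht0] at hs
    exact extendDensity_of_le (hs.2.trans ht)
  rw [h, intervalIntegral.integral_const_mul, intervalIntegral.mul_integral_comp_mul_left,
    mul_zero]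
  rfl

theorem pathPoint_extendDensity_one (hg : IntervalIntegrable g volume 0 1) :
    pathPoint (extendDensity g c) 1 = pathPoint g 1 + c := by
  have hl : ∫ s in (0:ℝ)..(1 / 2), extendDensity g c s = pathPoint g 1 := by
    have h := pathPoint_extendDensity_of_le (g := g) (c := c) (t := 1 / 2) (by norm_num) le_rfl
    rwa [mul_one_div_cancel two_ne_zero] at h
  have hr : ∫ s in (1 / 2 : ℝ)..1, extendDensity g c s = c := by
    rw [intervalIntegral.integral_congr_ae (g := fun _ => 2 * c)
      (Filter.Eventually.of_forall fun s hs => ?_)]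
    · rw [intervalIntegral.integral_const, smul_eq_mul]
      ring
    · rw [uIoc_of_le (by norm_num)] at hs
      exact extendDensity_of_gt hs.1
  rw [pathPoint, ← intervalIntegral.integral_add_adjacent_intervals
    (intervalIntegrable_extendDensity_left hg) intervalIntegrable_extendDensity_right, hl, hr]

theorem pathCost_extendDensity_half (f : ℝ × ℝ → ℝ) (g₁ g₂ : ℝ → ℝ) (c₁ c₂ : ℝ) :
    pathCost f (extendDensity g₁ c₁) (extendDensity g₂ c₂) 0 (1 / 2) = pathCost f g₁ g₂ 0 1 := by
  have h : pathCost f (extendDensity g₁ c₁) (extendDensity g₂ c₂) 0 (1 / 2) =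
      ∫ r in (0:ℝ)..(1 / 2), 2 * (fun r => f (pathPoint g₁ r, pathPoint g₂ r) *
        √(g₁ r * g₂ r)) (2 * r) := by
    refine intervalIntegral.integral_congr fun r hr => ?_
    rw [uIcc_of_le (by norm_num)] at hr
    have hs : √(2 * g₁ (2 * r) * (2 * g₂ (2 * r))) = 2 * √(g₁ (2 * r) * g₂ (2 * r)) := by
      rw [mul_mul_mul_comm, Real.sqrt_mul (by norm_num), Real.sqrt_mul_self zero_le_two]
    simp only [pathPoint_extendDensity_of_le hr.1 hr.2, extendDensity_of_le hr.2, hs]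
    ring
  rw [h, intervalIntegral.integral_const_mul, intervalIntegral.mul_integral_comp_mul_left
    (f := fun r => f (pathPoint g₁ r, pathPoint g₂ r) * √(g₁ r * g₂ r)),
    mul_zero, mul_one_div_cancel two_ne_zero]
  rfl

end extendDensity

theorem IsAdmissiblePath.extend {x y : ℝ × ℝ} {g₁ g₂ : ℝ → ℝ} (h : IsAdmissiblePath x g₁ g₂)
    (h₁ : x.1 ≤ y.1) (h₂ : x.2 ≤ y.2) :
    IsAdmissiblePath y (extendDensity g₁ (y.1 - x.1)) (extendDensity g₂ (y.2 - x.2)) := by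
  obtain ⟨i₁, i₂, p₁, p₂, e₁, e₂⟩ := h
  refine ⟨(intervalIntegrable_extendDensity_left i₁).trans intervalIntegrable_extendDensity_right,
    (intervalIntegrable_extendDensity_left i₂).trans intervalIntegrable_extendDensity_right,
    extendDensity_nonneg p₁ (sub_nonneg.2 h₁), extendDensity_nonneg p₂ (sub_nonneg.2 h₂), ?_, ?_⟩
  · rw [pathPoint_extendDensity_one i₁, e₁, add_sub_cancel]
  · rw [pathPoint_extendDensity_one i₂, e₂, add_sub_cancel]

/-- The value function is monotone nondecreasing with respect to the
componentwise partial order. -/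
theorem valueFun_monotone (f : ℝ × ℝ → ℝ)
    (hf : ContinuousOn f (Icc 0 1 ×ˢ Icc 0 1))
    (hf0 : ∀ x ∈ Icc (0:ℝ) 1 ×ˢ Icc (0:ℝ) 1, 0 ≤ f x)
    (x y : ℝ × ℝ) (hx : x ∈ Icc (0:ℝ) 1 ×ˢ Icc (0:ℝ) 1)
    (hy : y ∈ Icc (0:ℝ) 1 ×ˢ Icc (0:ℝ) 1)
    (h₁ : x.1 ≤ y.1) (h₂ : x.2 ≤ y.2) :
    valueFun f x ≤ valueFun f y := by
  refine csSup_le ⟨_, _, _, isAdmissiblePath_const hx, rfl⟩ ?_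
  rintro J ⟨g₁, g₂, hg, rfl⟩
  have hg' := hg.extend h₁ h₂
  refine le_trans ?_ (le_csSup (bddAbove_pathCost hf hy) ⟨_, _, hg', rfl⟩)
  rw [← pathCost_extendDensity_half f g₁ g₂ (y.1 - x.1) (y.2 - x.2)]
  refine intervalIntegral.integral_mono_interval le_rfl (by norm_num) (by norm_num) ?_
    (hg'.intervalIntegrable_cost hf hy)
  filter_upwards [ae_restrict_mem measurableSet_Ioc] with r hr
  exact mul_nonneg (hf0 _ (hg'.mem_unitSquare hy (Ioc_subset_Icc_self hr))) (Real.sqrt_nonneg _)
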